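/- Let 𝒜 be an abelian category and let P be a Serre class of objects of 𝒜 (a class containing the zero object and closed under subobjects, quotient objects and extensions), and let ℬ denote the full subcategory of 𝒜 on the objects satisfying P, with its induced abelian structure and exact inclusion functor. Assume: (a) for every short exact sequence 0 → B →^{i} A → A' → 0 in 𝒜 with B satisfying P, there exist an object B' satisfying P, a monomorphism i' : B → B' whose cokernel satisfies P, and a morphism p : A → B' with p ∘ i = i'; and (b) Ext^2_ℬ(X,Y) = 0 for all objects X, Y of ℬ. Then Ext^2_𝒜(X,Z) = 0 for all objects X, Z of 𝒜 satisfying P. -/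

import Mathlib

open CategoryTheory CategoryTheory.Abelian CategoryTheory.Limits

universe w₁ w₂ v₁ v₂ u₁ u₂

/-- In the derived category, every morphism between single objects placed in different degrees
is killed by a monomorphism out of its target. -/
lemma DerivedCategory.exists_mono_comp_singleFunctor_map_eq_zero
    {C : Type u₁} [Category.{v₁} C] [Abelian C] [HasDerivedCategory.{w₁} C]
    {X Z : C} {a b : ℤ} (hab : a ≠ b)
    (φ : (DerivedCategory.singleFunctor C a).obj X ⟶ (DerivedCategory.singleFunctor C b).obj Z) :
    ∃ (A : C) (i : Z ⟶ A), Mono i ∧ φ ≫ (DerivedCategory.singleFunctor C b).map i = 0 := by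
  obtain ⟨K, g, s, hs, hφ⟩ := DerivedCategory.left_fac
    (X := (HomologicalComplex.single C (ComplexShape.up ℤ) a).obj X)
    (Y := (HomologicalComplex.single C (ComplexShape.up ℤ) b).obj Z) φ
  have : QuasiIso s := (DerivedCategory.isIso_Q_map_iff_quasiIso C s).1 hs
  let p : K ⟶ (HomologicalComplex.single C (ComplexShape.up ℤ) b).obj (K.opcycles b) :=
    HomologicalComplex.mkHomToSingle (K.pOpcycles b) (by simp)
  let i : Z ⟶ K.opcycles b :=
    (HomologicalComplex.singleObjXSelf (ComplexShape.up ℤ) b Z).inv ≫ s.f b ≫ K.pOpcycles b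
  have hi : i = (HomologicalComplex.singleObjHomologySelfIso (ComplexShape.up ℤ) b Z).inv ≫
      HomologicalComplex.homologyMap s b ≫ K.homologyι b := by
    simp [i, HomologicalComplex.homologyι_naturality,
      HomologicalComplex.singleObjOpcyclesSelfIso]
  have hsp : s ≫ p = (HomologicalComplex.single C (ComplexShape.up ℤ) b).map i := by
    apply HomologicalComplex.to_single_hom_ext
    simp [p, i, HomologicalComplex.single_map_f_self]
  have hgp : g ≫ p = 0 := by
    apply HomologicalComplex.to_single_hom_ext
    exact (HomologicalComplex.isZero_single_obj_X _ _ _ _ hab.symm).eq_of_src _ _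
  refine ⟨_, i, ?_, ?_⟩
  · rw [hi]
    infer_instance
  · have h : (DerivedCategory.Q.map g ≫ inv (DerivedCategory.Q.map s)) ≫
        DerivedCategory.Q.map ((HomologicalComplex.single C (ComplexShape.up ℤ) b).map i) = 0 := by
      rw [← hsp, Functor.map_comp, Category.assoc, IsIso.inv_hom_id_assoc,
        ← Functor.map_comp, hgp, Functor.map_zero]
    rw [hφ]
    exact h

/-- Extension classes of positive degree are effaceable. -/
lemma CategoryTheory.Abelian.Ext.exists_mono_comp_mk₀_eq_zero
    {C : Type u₁} [Category.{v₁} C] [Abelian C] [HasExt.{w₁} C]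
    {X Z : C} {n : ℕ} (hn : n ≠ 0) (e : Ext X Z n) :
    ∃ (A : C) (i : Z ⟶ A), Mono i ∧ e.comp (Ext.mk₀ i) (add_zero n) = 0 := by
  let := HasDerivedCategory.standard C
  let σ := (DerivedCategory.singleFunctors C).shiftIso (n : ℤ) (-n) 0 (by simp)
  obtain ⟨A, i, hi, h⟩ := DerivedCategory.exists_mono_comp_singleFunctor_map_eq_zero
    (a := 0) (b := -n) (by lia) (e.hom ≫ σ.hom.app Z)
  refine ⟨A, i, hi, ?_⟩
  ext
  rw [← Ext.hom_comp_singleFunctor_map_shift, Ext.zero_hom, ← cancel_mono (σ.hom.app A),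
    Limits.zero_comp, ← h, Category.assoc, Category.assoc]
  congr 1
  exact σ.hom.naturality i

/-- Every extension class of positive degree is the product of a class of smaller degree and of
the class of a short exact sequence. -/
lemma CategoryTheory.Abelian.Ext.exists_comp_extClass_eq
    {C : Type u₁} [Category.{v₁} C] [Abelian C] [HasExt.{w₁} C]
    {X Z : C} {n m : ℕ} (h : n + 1 = m) (e : Ext X Z m) :
    ∃ (A Q : C) (i : Z ⟶ A) (q : A ⟶ Q) (w : i ≫ q = 0)
      (hS : (ShortComplex.mk i q w).ShortExact) (x : Ext X Q n), x.comp hS.extClass h = e := by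
  obtain ⟨A, i, hi, hei⟩ := e.exists_mono_comp_mk₀_eq_zero (by lia)
  have hS : (ShortComplex.mk i (cokernel.π i) (cokernel.condition i)).ShortExact :=
    { exact := ShortComplex.exact_cokernel i }
  obtain ⟨x, hx⟩ := Ext.covariant_sequence_exact₁ X hS e hei h
  exact ⟨_, _, i, _, _, hS, x, hx⟩

/-- The pullback of a short exact sequence along a morphism to its right end is short exact. -/
lemma CategoryTheory.ShortComplex.ShortExact.shortExact_pullback
    {C : Type u₁} [Category.{v₁} C] [Abelian C] {S : ShortComplex C} (hS : S.ShortExact)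
    {X : C} (x : X ⟶ S.X₃) :
    (ShortComplex.mk (pullback.lift S.f 0 (by simp) : S.X₁ ⟶ pullback S.g x)
      (pullback.snd S.g x) (pullback.lift_snd _ _ _)).ShortExact := by
  have := hS.mono_f
  have := hS.epi_g
  have hm : Mono (pullback.lift S.f 0 (by simp) : S.X₁ ⟶ pullback S.g x) :=
    mono_of_mono_fac (pullback.lift_fst _ _ _)
  refine { exact := ?_, mono_f := hm, epi_g := inferInstanceAs (Epi (pullback.snd S.g x)) }
  refine ShortComplex.exact_of_f_is_kernel _ (KernelFork.IsLimit.ofι _ _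
    (fun {W} k (hk : k ≫ pullback.snd S.g x = 0) ↦ hS.exact.lift (k ≫ pullback.fst S.g x) (by
      rw [Category.assoc, pullback.condition, reassoc_of% hk, zero_comp]))
    (fun {W} k (hk : k ≫ pullback.snd S.g x = 0) ↦ ?_)
    (fun {W} k hk m hm' ↦ ?_))
  · apply pullback.hom_ext
    · rw [Category.assoc, pullback.lift_fst, hS.exact.lift_f]
    · rw [Category.assoc, pullback.lift_snd, comp_zero, hk]
  · rw [← cancel_mono S.f, hS.exact.lift_f, ← hm', Category.assoc, pullback.lift_fst]

/-- Every extension class of degree one is the class of a short exact sequence. -/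
lemma CategoryTheory.Abelian.Ext.exists_extClass_eq
    {C : Type u₁} [Category.{v₁} C] [Abelian C] [HasExt.{w₁} C] {X Z : C} (e : Ext X Z 1) :
    ∃ (E : C) (f : Z ⟶ E) (g : E ⟶ X) (w : f ≫ g = 0)
      (hS : (ShortComplex.mk f g w).ShortExact), hS.extClass = e := by
  obtain ⟨A, Q, i, q, w, hS, x, rfl⟩ := e.exists_comp_extClass_eq (zero_add 1)
  obtain ⟨x, rfl⟩ := (Ext.mk₀_bijective X Q).2 x
  refine ⟨_, _, _, _, hS.shortExact_pullback x, ?_⟩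
  simpa using ShortComplex.ShortExact.extClass_naturality (hS.shortExact_pullback x) hS
    { τ₁ := 𝟙 _, τ₂ := pullback.fst _ _, τ₃ := x,
      comm₁₂ := (Category.id_comp _).trans (pullback.lift_fst _ _ _).symm,
      comm₂₃ := pullback.condition }

section

variable {A : Type u₂} [Category.{v₂} A] [Abelian A] [HasExt.{w₂} A]
  {B : Type u₁} [Category.{v₁} B] [Abelian B] [HasExt.{w₁} B]
  (ι : B ⥤ A) [ι.Full] [ι.Faithful] [ι.Additive]
  [PreservesFiniteLimits ι] [PreservesFiniteColimits ι]

/-- The class of a short exact sequence whose terms lie in the essential image of an exact fully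
faithful functor comes from the source of this functor. -/
lemma CategoryTheory.ShortComplex.ShortExact.exists_mapExactFunctor_eq_extClass
    {Y₁ Y₂ Y₃ : B} {E : A} (φ : ι.obj Y₂ ≅ E) {f : ι.obj Y₁ ⟶ E} {g : E ⟶ ι.obj Y₃}
    {w : f ≫ g = 0} (hS : (ShortComplex.mk f g w).ShortExact) :
    ∃ e : Ext Y₃ Y₁ 1, e.mapExactFunctor ι = hS.extClass := by
  let T : ShortComplex B := ShortComplex.mk (ι.preimage (f ≫ φ.inv)) (ι.preimage (φ.hom ≫ g))
    (ι.map_injective (by simp [w]))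
  let iso : T.map ι ≅ ShortComplex.mk f g w :=
    ShortComplex.isoMk (Iso.refl _) φ (Iso.refl _)
      (show 𝟙 (ι.obj Y₁) ≫ f = ι.map (ι.preimage (f ≫ φ.inv)) ≫ φ.hom by simp)
      (show φ.hom ≫ g = ι.map (ι.preimage (φ.hom ≫ g)) ≫ 𝟙 (ι.obj Y₃) by simp)
  have hT : T.ShortExact :=
    (ShortExact.shortExact_map_iff ι).1 ((ShortComplex.shortExact_iff_of_iso iso).2 hS)
  refine ⟨hT.extClass, ?_⟩
  rw [Ext.mapExactFunctor_extClass]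
  have h : (hT.map_of_exact ι).extClass.comp (Ext.mk₀ (𝟙 (ι.obj Y₁))) (add_zero 1) =
      (Ext.mk₀ (𝟙 (ι.obj Y₃))).comp hS.extClass (zero_add 1) :=
    (hT.map_of_exact ι).extClass_naturality hS iso.hom
  exact (Ext.comp_mk₀_id _).symm.trans (h.trans (Ext.mk₀_id_comp _))

/-- An exact fully faithful functor whose essential image is closed under extensions induces
surjections on `Ext` groups of degree one. -/
lemma CategoryTheory.Abelian.Ext.mapExactFunctor_one_surjective
    (hι : ∀ S : ShortComplex A, S.ShortExact → ι.essImage S.X₁ → ι.essImage S.X₃ →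
      ι.essImage S.X₂) (X Y : B) :
    Function.Surjective (Ext.mapExactFunctor ι : Ext X Y 1 → Ext (ι.obj X) (ι.obj Y) 1) := by
  intro e
  obtain ⟨E, f, g, w, hS, rfl⟩ := e.exists_extClass_eq
  obtain ⟨_, ⟨φ⟩⟩ := hι _ hS (ι.obj_mem_essImage Y) (ι.obj_mem_essImage X)
  exact hS.exists_mapExactFunctor_eq_extClass ι φ

end

/-- The vanishing of an extension class may be checked after transport along isomorphisms. -/
lemma CategoryTheory.Abelian.Ext.eq_zero_of_iso
    {C : Type u₁} [Category.{v₁} C] [Abelian C] [HasExt.{w₁} C] {X X' Z Z' : C} {n : ℕ}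
    (α : X' ≅ X) (β : Z' ≅ Z) (h : ∀ e : Ext X' Z' n, e = 0) (e : Ext X Z n) : e = 0 := by
  have he := h ((Ext.mk₀ α.hom).comp (e.comp (Ext.mk₀ β.inv) (add_zero n)) (zero_add n))
  have : (Ext.mk₀ α.inv).comp (((Ext.mk₀ α.hom).comp (e.comp (Ext.mk₀ β.inv) (add_zero n))
      (zero_add n)).comp (Ext.mk₀ β.hom) (add_zero n)) (zero_add n) = e := by
    simp
  rw [← this, he]
  simp

/-- Let `A` be an abelian category, `P` a Serre class of objects of `A` (containing
the zero objects and closed under subobjects, quotients and extensions), and let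
`B` (together with the exact fully faithful inclusion `ι : B ⥤ A` whose essential
image consists exactly of the objects satisfying `P`) play the role of the full
subcategory of `A` on `P` with its induced abelian structure. Assume:
(a) for every short exact sequence `0 → B₀ →ⁱ A₀ → A₀' → 0` in `A` with `P B₀`,
there are an object `B'` satisfying `P`, a monomorphism `i' : B₀ ⟶ B'` whose
cokernel satisfies `P`, and a morphism `p : A₀ ⟶ B'` with `p ∘ i = i'`; and
(b) `Ext²_B(X, Y) = 0` for all objects `X`, `Y` of `B`.
Then `Ext²_A(X, Z) = 0` for all objects `X`, `Z` of `A` satisfying `P`. -/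
theorem stmt_7
    {A : Type u₂} [Category.{v₂} A] [Abelian A] [HasExt.{w₂} A]
    {B : Type u₁} [Category.{v₁} B] [Abelian B] [HasExt.{w₁} B]
    (P : A → Prop)
    (hzero : ∀ Z : A, IsZero Z → P Z)
    (hsub : ∀ ⦃Z Z' : A⦄ (f : Z ⟶ Z'), Mono f → P Z' → P Z)
    (hquot : ∀ ⦃Z Z' : A⦄ (f : Z ⟶ Z'), Epi f → P Z → P Z')
    (hext : ∀ (S : ShortComplex A), S.ShortExact → P S.X₁ → P S.X₃ → P S.X₂)
    (ι : B ⥤ A) [ι.Full] [ι.Faithful] [ι.Additive]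
    [PreservesFiniteLimits ι] [PreservesFiniteColimits ι]
    (hι : ∀ Z : A, P Z ↔ ∃ Y : B, Nonempty (ι.obj Y ≅ Z))
    (hred : ∀ (S : ShortComplex A), S.ShortExact → P S.X₁ →
      ∃ (B' : A) (i' : S.X₁ ⟶ B') (p : S.X₂ ⟶ B'),
        P B' ∧ Mono i' ∧ P (cokernel i') ∧ S.f ≫ p = i')
    (hB : ∀ (X Y : B) (e : Ext X Y 2), e = 0) :
    ∀ (X Z : A), P X → P Z → ∀ e : Ext X Z 2, e = 0 := by
  intro X Z hX hZ
  obtain ⟨X₀, ⟨α⟩⟩ := (hι X).1 hX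
  obtain ⟨Z₀, ⟨β⟩⟩ := (hι Z).1 hZ
  refine Ext.eq_zero_of_iso α β fun e ↦ ?_
  obtain ⟨E, Q, i, q, w, hS, x, rfl⟩ := e.exists_comp_extClass_eq (one_add_one_eq_two)
  obtain ⟨B', i', p, hB', hi', hC, hp⟩ := hred _ hS ((hι _).2 ⟨Z₀, ⟨Iso.refl _⟩⟩)
  dsimp at i' p hp
  obtain ⟨Y, ⟨φ⟩⟩ := (hι B').1 hB'
  obtain ⟨C₀, ⟨γ⟩⟩ := (hι _).1 hC
  have hS₀ : (ShortComplex.mk i' (cokernel.π i') (cokernel.condition i')).ShortExact :=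
    { exact := ShortComplex.exact_cokernel i' }
  have hw' : i' ≫ cokernel.π i' ≫ γ.inv = 0 := by simp
  have hS' : (ShortComplex.mk i' (cokernel.π i' ≫ γ.inv) hw').ShortExact :=
    (ShortComplex.shortExact_iff_of_iso
      (S₁ := ShortComplex.mk i' (cokernel.π i') (cokernel.condition i'))
      (S₂ := ShortComplex.mk i' (cokernel.π i' ≫ γ.inv) hw')
      (ShortComplex.isoMk (Iso.refl _) (Iso.refl _) γ.symm)).1 hS₀
  have := hS.epi_g
  have hw : i ≫ p ≫ cokernel.π i' ≫ γ.inv = 0 := by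
    rw [reassoc_of% hp, cokernel.condition_assoc, zero_comp]
  have hnat := hS.extClass_naturality hS'
    { τ₁ := 𝟙 _, τ₂ := p, τ₃ := hS.exact.desc (p ≫ cokernel.π i' ≫ γ.inv) hw,
      comm₁₂ := by simp [hp], comm₂₃ := by simpa using (hS.exact.g_desc _ hw).symm }
  dsimp at hnat
  rw [Ext.comp_mk₀_id] at hnat
  obtain ⟨b, hb⟩ := hS'.exists_mapExactFunctor_eq_extClass ι φ
  obtain ⟨a, ha⟩ := Ext.mapExactFunctor_one_surjective ι
    (fun S hS h₁ h₃ ↦ (hι _).1 (hext S hS ((hι _).2 h₁) ((hι _).2 h₃))) X₀ C₀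
    (x.comp (Ext.mk₀ (hS.exact.desc (p ≫ cokernel.π i' ≫ γ.inv) hw)) (add_zero 1))
  rw [hnat, ← Ext.comp_assoc_of_second_deg_zero, ← ha, ← hb, ← Ext.mapExactFunctor_comp,
    hB _ _ (a.comp b _),
    Ext.mapExactFunctor_zero]
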